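/- Let ω be a rectilinearly-convex polygonal obstacle, and let S be a finite set of closed line segments contained in ω such that (1) the union of S intersects each of the four extreme edges of ω, and (2) the union of S is a connected set. Then S is a skeleton for ω. -/

import Mathlib

open Set

/-- A point in the plane. -/
abbrev Pt : Type := ℝ × ℝ

/-- The union of a finite set of closed line segments, given by their endpoint pairs. -/
def segUnion (S : Finset (Pt × Pt)) : Set Pt := ⋃ s ∈ S, segment ℝ s.1 s.2

/-- The two candidate corner points for a shortest rectilinear path with at most one
corner point from `p` to `q`.  (If `p` and `q` are axis-aligned both candidates give
the straight segment `pq`.) -/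
def cornerPts (p q : Pt) : Set Pt := {(p.1, q.2), (q.1, p.2)}

/-- The rectilinear path from `p` to `q` through the corner point `c`. -/
def lpath (p c q : Pt) : Set Pt := segment ℝ p c ∪ segment ℝ c q

/-- The axis-aligned bounding box of a set of points. -/
noncomputable def bboxOf (X : Set Pt) : Set Pt :=
  Icc (sInf (Prod.fst '' X)) (sSup (Prod.fst '' X)) ×ˢ
    Icc (sInf (Prod.snd '' X)) (sSup (Prod.snd '' X))

/-- A compact simple rectilinear polygon in the plane that is rectilinearly convex:
it is compact, connected, has nonempty interior, every axis-parallel segment with both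
endpoints in it lies inside it (ortho-convexity; for connected rectilinear polygons this
is equivalent to rectilinear convexity), and its boundary is a finite union of
axis-parallel edges. -/
structure RectObstacle where
  carrier : Set Pt
  edges : Finset (Pt × Pt)
  compact' : IsCompact carrier
  connected' : IsConnected carrier
  interior_ne : (interior carrier).Nonempty
  ortho : ∀ a ∈ carrier, ∀ b ∈ carrier, (a.1 = b.1 ∨ a.2 = b.2) → segment ℝ a b ⊆ carrier
  boundary_eq : frontier carrier = ⋃ e ∈ edges, segment ℝ e.1 e.2
  edges_axis : ∀ e ∈ edges, e.1.1 = e.2.1 ∨ e.1.2 = e.2.2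

namespace RectObstacle

noncomputable def xmin (ω : RectObstacle) : ℝ := sInf (Prod.fst '' ω.carrier)
noncomputable def xmax (ω : RectObstacle) : ℝ := sSup (Prod.fst '' ω.carrier)
noncomputable def ymin (ω : RectObstacle) : ℝ := sInf (Prod.snd '' ω.carrier)
noncomputable def ymax (ω : RectObstacle) : ℝ := sSup (Prod.snd '' ω.carrier)

/-- The segment `s` lies inside the obstacle. -/
def InOb (ω : RectObstacle) (s : Pt × Pt) : Prop := segment ℝ s.1 s.2 ⊆ ω.carrier

/-- `S` is a skeleton for `ω`: its segments lie in `ω`, and for any two points outside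
the interior of `ω`, if every shortest rectilinear path with at most one corner point
between them meets the interior of `ω`, then each such path intersects the union of `S`. -/
def IsSkeleton (ω : RectObstacle) (S : Finset (Pt × Pt)) : Prop :=
  segUnion S ⊆ ω.carrier ∧
  ∀ p q : Pt, p ∉ interior ω.carrier → q ∉ interior ω.carrier →
    (∀ c ∈ cornerPts p q, (lpath p c q ∩ interior ω.carrier).Nonempty) →
    ∀ c ∈ cornerPts p q, (lpath p c q ∩ segUnion S).Nonempty

/-- A minimum skeleton: a skeleton with the least possible number of segments. -/
def IsMinSkeleton (ω : RectObstacle) (S : Finset (Pt × Pt)) : Prop :=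
  ω.IsSkeleton S ∧ ∀ T : Finset (Pt × Pt), ω.IsSkeleton T → S.card ≤ T.card

/-- A set `A ⊆ ω` intersects the four extreme edges of `ω` (equivalently, it contains
points at each of the four extreme coordinates of `ω`). -/
def TouchesExtremes (ω : RectObstacle) (A : Set Pt) : Prop :=
  (∃ p ∈ A, p.1 = ω.xmin) ∧ (∃ p ∈ A, p.1 = ω.xmax) ∧
  (∃ p ∈ A, p.2 = ω.ymin) ∧ (∃ p ∈ A, p.2 = ω.ymax)

/-- The set of extreme corners of `ω`: corners of its bounding box belonging to `ω`. -/
def extremeCornerSet (ω : RectObstacle) : Set Pt :=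
  ω.carrier ∩ {(ω.xmin, ω.ymin), (ω.xmax, ω.ymin), (ω.xmin, ω.ymax), (ω.xmax, ω.ymax)}

/-- `ω` has a diagonal: a segment inside `ω` joining two opposite extreme corners. -/
def HasDiagonal (ω : RectObstacle) : Prop :=
  segment ℝ (ω.xmin, ω.ymin) (ω.xmax, ω.ymax) ⊆ ω.carrier ∨
  segment ℝ (ω.xmax, ω.ymin) (ω.xmin, ω.ymax) ⊆ ω.carrier

/-- A cross: `sH` is a segment in `ω` with one endpoint on each horizontal extreme edge
and `sV` a segment in `ω` with one endpoint on each vertical extreme edge. -/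
def IsCross (ω : RectObstacle) (sH sV : Pt × Pt) : Prop :=
  ω.InOb sH ∧ ω.InOb sV ∧
  sH.1.2 = ω.ymin ∧ sH.2.2 = ω.ymax ∧ sV.1.1 = ω.xmin ∧ sV.2.1 = ω.xmax

/-- `e` is the left extreme edge of `ω`. -/
def IsLeftExtreme (ω : RectObstacle) (e : Pt × Pt) : Prop :=
  e ∈ ω.edges ∧ e.1.1 = ω.xmin ∧ e.2.1 = ω.xmin

def IsRightExtreme (ω : RectObstacle) (e : Pt × Pt) : Prop :=
  e ∈ ω.edges ∧ e.1.1 = ω.xmax ∧ e.2.1 = ω.xmax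

def IsBottomExtreme (ω : RectObstacle) (e : Pt × Pt) : Prop :=
  e ∈ ω.edges ∧ e.1.2 = ω.ymin ∧ e.2.2 = ω.ymin

def IsTopExtreme (ω : RectObstacle) (e : Pt × Pt) : Prop :=
  e ∈ ω.edges ∧ e.1.2 = ω.ymax ∧ e.2.2 = ω.ymax

/-- `e` is one of the four extreme edges of `ω`. -/
def IsExtremeEdge (ω : RectObstacle) (e : Pt × Pt) : Prop :=
  ω.IsLeftExtreme e ∨ ω.IsRightExtreme e ∨ ω.IsBottomExtreme e ∨ ω.IsTopExtreme e

/-- `s` is a maximum-length visibility edge: a segment inside `ω` that cannot be properly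
extended within `ω`. -/
def MaxLenSeg (ω : RectObstacle) (s : Pt × Pt) : Prop :=
  ω.InOb s ∧ ∀ t : Pt × Pt, segment ℝ s.1 s.2 ⊆ segment ℝ t.1 t.2 → ω.InOb t →
    segment ℝ t.1 t.2 = segment ℝ s.1 s.2

end RectObstacle

/-- The set `A` is weakly connected: treating each maximal connected component as a
vertex, with components `C`, `D` adjacent whenever `C` meets the bounding box of `D`
and `D` meets the bounding box of `C`, the resulting graph is connected. -/
def WeaklyConnected (A : Set Pt) : Prop :=
  ∀ x ∈ A, ∀ y ∈ A,
    Relation.ReflTransGen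
      (fun C D : Set Pt =>
        (∃ a ∈ A, C = connectedComponentIn A a) ∧
        (∃ b ∈ A, D = connectedComponentIn A b) ∧
        (C ∩ bboxOf D).Nonempty ∧ (D ∩ bboxOf C).Nonempty)
      (connectedComponentIn A x) (connectedComponentIn A y)

open Filter Topology

/-- `K` is an orthoconvex preconnected planar set and `U` is a preconnected subset of `K`
reaching at least as far as `K` in each of the four axis directions. -/
structure SpansOrthoconvex (K U : Set Pt) : Prop where
  vert : ∀ {x y₁ y y₂ : ℝ}, (x, y₁) ∈ K → (x, y₂) ∈ K → y₁ ≤ y → y ≤ y₂ → (x, y) ∈ K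
  horiz : ∀ {y x₁ x x₂ : ℝ}, (x₁, y) ∈ K → (x₂, y) ∈ K → x₁ ≤ x → x ≤ x₂ → (x, y) ∈ K
  preconn : IsPreconnected K
  subset : U ⊆ K
  preconn_sub : IsPreconnected U
  left : ∀ k ∈ K, ∃ u ∈ U, u.1 ≤ k.1
  right : ∀ k ∈ K, ∃ u ∈ U, k.1 ≤ u.1
  bot : ∀ k ∈ K, ∃ u ∈ U, u.2 ≤ k.2
  top : ∀ k ∈ K, ∃ u ∈ U, k.2 ≤ u.2

/-- Reflection of the plane in the vertical axis. -/
def reflectX : Pt ≃ₜ Pt := (Homeomorph.neg ℝ).prodCongr (Homeomorph.refl ℝ)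

/-- Reflection of the plane in the horizontal axis. -/
def reflectY : Pt ≃ₜ Pt := (Homeomorph.refl ℝ).prodCongr (Homeomorph.neg ℝ)

/-- Reflection of the plane in the diagonal. -/
def reflectDiag : Pt ≃ₜ Pt := Homeomorph.prodComm ℝ ℝ

@[simp] lemma reflectX_apply (p : Pt) : reflectX p = (-p.1, p.2) := rfl

@[simp] lemma reflectY_apply (p : Pt) : reflectY p = (p.1, -p.2) := rfl

@[simp] lemma reflectDiag_apply (p : Pt) : reflectDiag p = (p.2, p.1) := rfl

lemma exists_box_of_mem_interior {K : Set Pt} {x y : ℝ} (h : (x, y) ∈ interior K) :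
    ∃ δ > 0, ∀ x' y' : ℝ, |x' - x| < δ → |y' - y| < δ → (x', y') ∈ K := by
  obtain ⟨δ, hδ, hb⟩ := Metric.mem_nhds_iff.1 (mem_interior_iff_mem_nhds.1 h)
  refine ⟨δ, hδ, fun x' y' hx hy => hb ?_⟩
  rw [Metric.mem_ball, Prod.dist_eq, Real.dist_eq, Real.dist_eq]
  exact max_lt hx hy

lemma exists_lt_fst_of_mem_interior {K : Set Pt} {x y : ℝ} (h : (x, y) ∈ interior K) :
    ∃ k ∈ K, k.1 < x := by
  obtain ⟨δ, hδ, hbox⟩ := exists_box_of_mem_interior h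
  refine ⟨(x - δ / 2, y), hbox _ _ ?_ (by simpa using hδ), by simpa using hδ⟩
  rw [sub_sub_cancel_left, abs_neg, abs_of_pos (half_pos hδ)]
  exact half_lt_self hδ

lemma exists_snd_lt_of_mem_interior {K : Set Pt} {x y : ℝ} (h : (x, y) ∈ interior K) :
    ∃ k ∈ K, k.2 < y := by
  obtain ⟨δ, hδ, hbox⟩ := exists_box_of_mem_interior h
  refine ⟨(x, y - δ / 2), hbox _ _ (by simpa using hδ) ?_, by simpa using hδ⟩
  rw [sub_sub_cancel_left, abs_neg, abs_of_pos (half_pos hδ)]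
  exact half_lt_self hδ

lemma exists_lt_snd_of_mem_interior {K : Set Pt} {x y : ℝ} (h : (x, y) ∈ interior K) :
    ∃ k ∈ K, y < k.2 := by
  obtain ⟨δ, hδ, hbox⟩ := exists_box_of_mem_interior h
  refine ⟨(x, y + δ / 2), hbox _ _ (by simpa using hδ) ?_, by simpa using hδ⟩
  rw [add_sub_cancel_left, abs_of_pos (half_pos hδ)]
  exact half_lt_self hδ

lemma eventually_nhdsWithin_fst {u : Pt} {p : ℝ → Prop} (h : ∀ᶠ x in 𝓝 u.1, p x) {U : Set Pt} :
    ∀ᶠ v in 𝓝[U] u, p v.1 :=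
  nhdsWithin_le_nhds (continuous_fst.continuousAt.eventually h)

lemma eventually_nhdsWithin_snd {u : Pt} {p : ℝ → Prop} (h : ∀ᶠ y in 𝓝 u.2, p y) {U : Set Pt} :
    ∀ᶠ v in 𝓝[U] u, p v.2 :=
  nhdsWithin_le_nhds (continuous_snd.continuousAt.eventually h)

lemma mem_segment_vertical {a b e x y : ℝ} :
    (x, y) ∈ segment ℝ ((a, b) : Pt) (a, e) ↔ x = a ∧ y ∈ uIcc b e := by
  rw [← Prod.image_mk_segment_right, segment_eq_uIcc]
  simp [eq_comm, and_comm]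

lemma mem_segment_horizontal {a b e x y : ℝ} :
    (x, y) ∈ segment ℝ ((a, b) : Pt) (e, b) ↔ y = b ∧ x ∈ uIcc a e := by
  rw [← Prod.image_mk_segment_left, segment_eq_uIcc]
  simp [eq_comm, and_comm]

lemma exists_prop_of_or {p q : Prop} (h : p ∨ q) : ∃ α : Prop, (¬ α → p) ∧ (α → q) :=
  ⟨q, fun hq => h.resolve_right hq, id⟩

namespace SpansOrthoconvex

variable {K U : Set Pt}

lemma reflectX (h : SpansOrthoconvex K U) :
    SpansOrthoconvex (reflectX ⁻¹' K) (reflectX ⁻¹' U) where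
  vert h₁ h₂ := h.vert h₁ h₂
  horiz h₁ h₂ h₃ h₄ := h.horiz h₂ h₁ (neg_le_neg h₄) (neg_le_neg h₃)
  preconn := (Homeomorph.isPreconnected_preimage _).2 h.preconn
  subset := preimage_mono h.subset
  preconn_sub := (Homeomorph.isPreconnected_preimage _).2 h.preconn_sub
  left _ hk := by
    obtain ⟨u, hu, hle⟩ := h.right _ hk
    exact ⟨(-u.1, u.2), by simpa using hu, by simpa [neg_le] using hle⟩
  right _ hk := by
    obtain ⟨u, hu, hle⟩ := h.left _ hk
    exact ⟨(-u.1, u.2), by simpa using hu, by simpa [le_neg] using hle⟩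
  bot _ hk := by
    obtain ⟨u, hu, hle⟩ := h.bot _ hk
    exact ⟨(-u.1, u.2), by simpa using hu, hle⟩
  top _ hk := by
    obtain ⟨u, hu, hle⟩ := h.top _ hk
    exact ⟨(-u.1, u.2), by simpa using hu, hle⟩

lemma reflectDiag (h : SpansOrthoconvex K U) :
    SpansOrthoconvex (reflectDiag ⁻¹' K) (reflectDiag ⁻¹' U) where
  vert h₁ h₂ := h.horiz h₁ h₂
  horiz h₁ h₂ := h.vert h₁ h₂
  preconn := (Homeomorph.isPreconnected_preimage _).2 h.preconn
  subset := preimage_mono h.subset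
  preconn_sub := (Homeomorph.isPreconnected_preimage _).2 h.preconn_sub
  left _ hk := let ⟨u, hu, hle⟩ := h.bot _ hk; ⟨(u.2, u.1), hu, hle⟩
  right _ hk := let ⟨u, hu, hle⟩ := h.top _ hk; ⟨(u.2, u.1), hu, hle⟩
  bot _ hk := let ⟨u, hu, hle⟩ := h.left _ hk; ⟨(u.2, u.1), hu, hle⟩
  top _ hk := let ⟨u, hu, hle⟩ := h.right _ hk; ⟨(u.2, u.1), hu, hle⟩

lemma reflectY (h : SpansOrthoconvex K U) :
    SpansOrthoconvex (reflectY ⁻¹' K) (reflectY ⁻¹' U) :=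
  h.reflectDiag.reflectX.reflectDiag

/-- A point strictly inside a rectangle whose four corners lie in `K` is interior to `K`. -/
lemma mem_interior_of_corners (h : SpansOrthoconvex K U) {x₁ x₂ y₁ y₂ x y : ℝ}
    (h₁₁ : (x₁, y₁) ∈ K) (h₁₂ : (x₁, y₂) ∈ K) (h₂₁ : (x₂, y₁) ∈ K) (h₂₂ : (x₂, y₂) ∈ K)
    (hx₁ : x₁ < x) (hx₂ : x < x₂) (hy₁ : y₁ < y) (hy₂ : y < y₂) : (x, y) ∈ interior K := by
  refine mem_interior.2 ⟨Ioo x₁ x₂ ×ˢ Ioo y₁ y₂, ?_, isOpen_Ioo.prod isOpen_Ioo,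
    ⟨⟨hx₁, hx₂⟩, hy₁, hy₂⟩⟩
  rintro ⟨a, b⟩ ⟨⟨ha₁, ha₂⟩, hb₁, hb₂⟩
  exact h.vert (h.horiz h₁₁ h₂₁ ha₁.le ha₂.le) (h.horiz h₁₂ h₂₂ ha₁.le ha₂.le) hb₁.le hb₂.le

/-- A horizontal line through an interior point of `K` cannot be approached within `K`
from both sides beyond a non-interior point to the right of it. -/
lemma one_sided_right (h : SpansOrthoconvex K U) {x₀ x₁ y₀ : ℝ} (hc : (x₀, y₀) ∈ interior K)
    (hq : (x₁, y₀) ∉ interior K) (hlt : x₀ < x₁) :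
    (∀ x > x₁, ∀ᶠ u in 𝓝 ((x, y₀) : Pt), u ∈ K → u.2 ≤ y₀) ∨
      ∀ x > x₁, ∀ᶠ u in 𝓝 ((x, y₀) : Pt), u ∈ K → y₀ ≤ u.2 := by
  obtain ⟨δ, hδ, hbox⟩ := exists_box_of_mem_interior hc
  by_contra! hcon
  obtain ⟨⟨a, ha, hfa⟩, b, hb, hfb⟩ := hcon
  have near : ∀ x > x₁, ∀ᶠ u in 𝓝 ((x, y₀) : Pt), x₁ < u.1 ∧ |u.2 - y₀| < δ := fun x hx =>
    (continuous_fst.continuousAt.eventually (lt_mem_nhds hx)).and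
      ((continuous_snd.tendsto ((x, y₀) : Pt)).eventually (eventually_abs_sub_lt y₀ hδ))
  obtain ⟨u, ⟨huK, hu⟩, hu₁, huδ⟩ := (hfa.and_eventually (near a ha)).exists
  obtain ⟨v, ⟨hvK, hv⟩, hv₁, hvδ⟩ := (hfb.and_eventually (near b hb)).exists
  have hu₀ : (x₀, u.2) ∈ K := hbox _ _ (by simpa using hδ) huδ
  have hv₀ : (x₀, v.2) ∈ K := hbox _ _ (by simpa using hδ) hvδ
  have hm : x₀ ≤ min u.1 v.1 := le_min (hlt.trans hu₁).le (hlt.trans hv₁).le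
  exact hq (h.mem_interior_of_corners hv₀ hu₀ (h.horiz hv₀ hvK hm (min_le_right _ _))
    (h.horiz hu₀ huK hm (min_le_left _ _)) hlt (lt_min hu₁ hv₁) hv hu)

lemma one_sided_left (h : SpansOrthoconvex K U) {x₀ x₁ y₀ : ℝ} (hc : (x₀, y₀) ∈ interior K)
    (hq : (x₁, y₀) ∉ interior K) (hlt : x₁ < x₀) :
    (∀ x < x₁, ∀ᶠ u in 𝓝 ((x, y₀) : Pt), u ∈ K → u.2 ≤ y₀) ∨
      ∀ x < x₁, ∀ᶠ u in 𝓝 ((x, y₀) : Pt), u ∈ K → y₀ ≤ u.2 := by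
  have key := h.reflectX.one_sided_right (x₀ := -x₀) (x₁ := -x₁) (y₀ := y₀)
    (by rw [← Homeomorph.preimage_interior]; simpa using hc)
    (by rw [← Homeomorph.preimage_interior]; simpa using hq) (neg_lt_neg hlt)
  refine key.imp ?_ ?_ <;>
  · intro hk x hx
    have := (_root_.reflectX.continuous.tendsto ((x, y₀) : Pt)).eventually
      (hk (-x) (neg_lt_neg hx))
    simpa using this

/-- A vertical line strictly between two points of `K` meets `K` inside the rectangle
spanned by these points, when the left one is the upper one. -/
lemma exists_mem_between (h : SpansOrthoconvex K U) {x₁ x₂ y₁ y₂ t : ℝ} (h₁ : (x₁, y₂) ∈ K)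
    (h₂ : (x₂, y₁) ∈ K) (ht₁ : x₁ < t) (ht₂ : t < x₂) (hy : y₁ ≤ y₂) :
    ∃ y, y₁ ≤ y ∧ y ≤ y₂ ∧ (t, y) ∈ K := by
  by_contra! hno
  have hy₁ : (t, y₁) ∉ K := hno _ le_rfl hy
  have hy₂ : (t, y₂) ∉ K := hno _ hy le_rfl
  have hlt : y₁ < y₂ := hy.lt_of_ne fun he => hy₂ (h.horiz h₁ (he ▸ h₂) ht₁.le ht₂.le)
  have sign : ∀ m : Pt → ℝ, Continuous m → (∀ u ∈ K, m u ≠ 0) → ∀ u ∈ K, ∀ v ∈ K,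
      m u < 0 → 0 < m v → False := fun m hm h₀ u hu v hv hmu hmv => by
    obtain ⟨w, hw, hmw⟩ := h.preconn.intermediate_value hu hv hm.continuousOn ⟨hmu.le, hmv.le⟩
    exact h₀ w hw hmw
  by_cases hbelow : ∃ y < y₁, (t, y) ∈ K
  · obtain ⟨b, hb, hbK⟩ := hbelow
    refine sign (fun u => min (t - u.1) (u.2 - y₁)) (by fun_prop) ?_ _ h₂ _ h₁
      (min_lt_of_left_lt (sub_neg.2 ht₂)) (lt_min (sub_pos.2 ht₁) (sub_pos.2 hlt))
    rintro ⟨a, c⟩ hu hmin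
    rcases min_eq_iff.1 hmin with ⟨h₀, h₀'⟩ | ⟨h₀, h₀'⟩
    · obtain rfl : t = a := sub_eq_zero.1 h₀
      exact hy₁ (h.vert hbK hu hb.le (by linarith))
    · obtain rfl : c = y₁ := sub_eq_zero.1 h₀
      exact hy₁ (h.horiz hu h₂ (by linarith) ht₂.le)
  · refine sign (fun u => min (u.1 - t) (y₂ - u.2)) (by fun_prop) ?_ _ h₁ _ h₂
      (min_lt_of_left_lt (sub_neg.2 ht₁)) (lt_min (sub_pos.2 ht₂) (sub_pos.2 hlt))
    rintro ⟨a, c⟩ hu hmin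
    rcases min_eq_iff.1 hmin with ⟨h₀, h₀'⟩ | ⟨h₀, h₀'⟩
    · obtain rfl : a = t := sub_eq_zero.1 h₀
      rcases lt_or_ge c y₁ with hl | hl
      · exact hbelow ⟨c, hl, hu⟩
      · exact hno c hl (by linarith) hu
    · obtain rfl : y₂ = c := sub_eq_zero.1 h₀
      exact hy₂ (h.horiz h₁ hu ht₁.le (by linarith))

/-- If `(x₀, y₀)` and `(s, y₁)` are interior, with the second one to the upper right, and
`(x₀, y₁)` is not, then no point of `K` lies to the upper left of `(x₀, y₁)`. -/
lemma notMem_of_upper_left (h : SpansOrthoconvex K U) {x₀ y₀ y₁ s : ℝ}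
    (hc : (x₀, y₀) ∈ interior K) (hz : (s, y₁) ∈ interior K) (hp : (x₀, y₁) ∉ interior K)
    (hs : x₀ < s) (hy : y₀ < y₁) {a b : ℝ} (ha : a < x₀) (hb : y₁ < b) : (a, b) ∉ K := by
  intro hab
  obtain ⟨δ, hδ, hbox⟩ := exists_box_of_mem_interior hc
  obtain ⟨ε, hε, hbox'⟩ := exists_box_of_mem_interior hz
  obtain ⟨d, hd, hd'⟩ := exists_between (lt_min hδ (sub_pos.2 ha))
  obtain ⟨e, he, he'⟩ := exists_between (lt_min hε (lt_min (sub_pos.2 hb) (sub_pos.2 hy)))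
  simp only [lt_min_iff] at hd' he'
  have hl : (x₀ - d, y₀) ∈ K := hbox _ _ (by simpa [abs_of_pos hd] using hd'.1) (by simpa using hδ)
  have hzu : (s, y₁ + e) ∈ K := hbox' _ _ (by simpa using hε) (by simpa [abs_of_pos he] using he'.1)
  have hzd : (s, y₁ - e) ∈ K := hbox' _ _ (by simpa using hε) (by simpa [abs_of_pos he] using he'.1)
  obtain ⟨y, hy₁, -, hyK⟩ := h.exists_mem_between (t := x₀ - d) hab hzu (by linarith)
    (by linarith) (by linarith)
  exact hp (h.mem_interior_of_corners (h.vert hl hyK (by linarith) (by linarith))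
    (h.vert hl hyK (by linarith) hy₁) hzd hzu (by linarith) hs (by linarith) (by linarith))

/-- `U` crosses every corner path whose corner is interior to `K` and whose ends are not,
provided the opposite path has an interior point on its horizontal leg. -/
lemma exists_mem_corner_of_lt (h : SpansOrthoconvex K U) {x₀ y₀ x₁ y₁ s : ℝ}
    (hc : (x₀, y₀) ∈ interior K) (hp : (x₀, y₁) ∉ interior K) (hq : (x₁, y₀) ∉ interior K)
    (hz : (s, y₁) ∈ interior K) (hx : x₀ < x₁) (hy : y₀ < y₁) (hs : x₀ < s) :
    ∃ u ∈ U, (u.1 = x₀ ∧ u.2 ∈ Icc y₀ y₁) ∨ (u.2 = y₀ ∧ u.1 ∈ Icc x₀ x₁) := by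
  by_contra! hno
  have hempty : ∀ u ∈ U, u.1 < x₀ → y₁ < u.2 → False := fun u hu h₁ h₂ =>
    h.notMem_of_upper_left hc hz hp hs hy h₁ h₂ (h.subset hu)
  obtain ⟨α, hup, hdown⟩ := exists_prop_of_or (h.one_sided_right hc hq hx)
  have hloc : ∀ u ∈ U, ∀ᶠ v in 𝓝[U] u, ((x₀ ≤ u.1 ∧ (y₀ < u.2 ∨ u.2 = y₀ ∧ α)) ↔
      (x₀ ≤ v.1 ∧ (y₀ < v.2 ∨ v.2 = y₀ ∧ α))) := by
    rintro ⟨a, b⟩ hu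
    obtain ⟨hno₁, hno₂⟩ := hno _ hu
    rcases lt_or_ge a x₀ with ha | ha
    · filter_upwards [eventually_nhdsWithin_fst (gt_mem_nhds ha)] with v hv
      exact iff_of_false (fun hf => ha.not_ge hf.1) fun hf => hv.not_ge hf.1
    rcases lt_trichotomy b y₀ with hb | rfl | hb
    · filter_upwards [eventually_nhdsWithin_snd (gt_mem_nhds hb)] with v hv
      exact iff_of_false (fun hf => hf.2.elim hb.not_gt fun he => hb.ne he.1)
        fun hf => hf.2.elim hv.not_gt fun he => hv.ne he.1
    · have hax : x₁ < a := lt_of_not_ge fun hle => hno₂ rfl ⟨ha, hle⟩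
      by_cases hα : α
      · filter_upwards [eventually_nhdsWithin_fst (lt_mem_nhds hax),
          nhdsWithin_le_nhds (hdown hα a hax), self_mem_nhdsWithin] with v hv hv' hvU
        refine iff_of_true ⟨ha, .inr ⟨rfl, hα⟩⟩ ⟨(hx.trans hv).le, ?_⟩
        exact (hv' (h.subset hvU)).lt_or_eq.imp id fun he => ⟨he.symm, hα⟩
      · filter_upwards [nhdsWithin_le_nhds (hup hα a hax), self_mem_nhdsWithin] with v hv hvU
        exact iff_of_false (fun hf => hf.2.elim (lt_irrefl _) fun he => hα he.2)
          fun hf => hf.2.elim (hv (h.subset hvU)).not_gt fun he => hα he.2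
    · rcases ha.lt_or_eq with ha | rfl
      · filter_upwards [eventually_nhdsWithin_fst (lt_mem_nhds ha),
          eventually_nhdsWithin_snd (lt_mem_nhds hb)] with v hv hv'
        exact iff_of_true ⟨ha.le, .inl hb⟩ ⟨hv.le, .inl hv'⟩
      · have hby : y₁ < b := lt_of_not_ge fun hle => hno₁ rfl ⟨hb.le, hle⟩
        filter_upwards [eventually_nhdsWithin_snd (lt_mem_nhds hby), self_mem_nhdsWithin]
          with v hv hvU
        exact iff_of_true ⟨le_rfl, .inl hb⟩
          ⟨le_of_not_gt fun hlt => hempty v hvU hlt hv, .inl (hy.trans hv)⟩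
  obtain ⟨k, hk, hkx⟩ := exists_lt_fst_of_mem_interior hc
  obtain ⟨u, hu, huk⟩ := h.left k hk
  obtain ⟨l, hl, hly⟩ := exists_lt_snd_of_mem_interior hz
  obtain ⟨v, hv, hvl⟩ := h.top l hl
  have hvy : y₁ < v.2 := hly.trans_le hvl
  have hiff := h.preconn_sub.induction₂ _ hloc (fun _ _ _ _ _ _ => Iff.trans)
    (fun _ _ _ _ => Iff.symm) hv hu
  exact (huk.trans_lt hkx).not_ge
    (hiff.1 ⟨le_of_not_gt fun hlt => hempty v hv hlt hvy, .inl (hy.trans hvy)⟩).1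

lemma exists_mem_corner (h : SpansOrthoconvex K U) {x₀ y₀ x₁ y₁ s : ℝ}
    (hc : (x₀, y₀) ∈ interior K) (hp : (x₀, y₁) ∉ interior K) (hq : (x₁, y₀) ∉ interior K)
    (hz : (s, y₁) ∈ interior K) (hs : s ∈ uIcc x₀ x₁) :
    ∃ u ∈ U, (u.1 = x₀ ∧ u.2 ∈ uIcc y₀ y₁) ∨ (u.2 = y₀ ∧ u.1 ∈ uIcc x₀ x₁) := by
  wlog hx : x₀ < x₁ generalizing K U x₀ x₁ s
  · have hx' : -x₀ < -x₁ := by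
      refine neg_lt_neg ((not_lt.1 hx).lt_of_ne ?_)
      rintro rfl
      exact hq hc
    obtain ⟨u, hu, hu'⟩ := this h.reflectX (x₀ := -x₀) (x₁ := -x₁) (s := -s)
      (by rw [← Homeomorph.preimage_interior]; simpa using hc)
      (by rw [← Homeomorph.preimage_interior]; simpa using hp)
      (by rw [← Homeomorph.preimage_interior]; simpa using hq)
      (by rw [← Homeomorph.preimage_interior]; simpa using hz)
      (by rw [mem_uIcc] at hs ⊢; grind) hx'
    refine ⟨_, hu, ?_⟩
    rw [reflectX_apply]
    rw [mem_uIcc, mem_uIcc] at hu' ⊢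
    grind
  wlog hy : y₀ < y₁ generalizing K U y₀ y₁
  · have hy' : -y₀ < -y₁ := by
      refine neg_lt_neg ((not_lt.1 hy).lt_of_ne ?_)
      rintro rfl
      exact hp hc
    obtain ⟨u, hu, hu'⟩ := this h.reflectY (y₀ := -y₀) (y₁ := -y₁)
      (by rw [← Homeomorph.preimage_interior]; simpa using hc)
      (by rw [← Homeomorph.preimage_interior]; simpa using hp)
      (by rw [← Homeomorph.preimage_interior]; simpa using hq)
      (by rw [← Homeomorph.preimage_interior]; simpa using hz) hy'
    refine ⟨_, hu, ?_⟩
    rw [reflectY_apply]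
    rw [mem_uIcc, mem_uIcc] at hu' ⊢
    grind
  rw [uIcc_of_lt hx] at hs ⊢
  rw [uIcc_of_lt hy]
  refine h.exists_mem_corner_of_lt hc hp hq hz hx hy (hs.1.lt_of_ne ?_)
  rintro rfl
  exact hp hz

/-- `U` crosses every horizontal segment which meets the interior of `K` and has
non-interior endpoints. -/
lemma exists_mem_horizontal_of_lt (h : SpansOrthoconvex K U) {x₀ x₁ x₂ y₀ : ℝ}
    (hc : (x₀, y₀) ∈ interior K) (hp : (x₁, y₀) ∉ interior K) (hq : (x₂, y₀) ∉ interior K)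
    (hx₁ : x₁ < x₀) (hx₂ : x₀ < x₂) : ∃ u ∈ U, u.2 = y₀ ∧ u.1 ∈ Icc x₁ x₂ := by
  by_contra! hno
  obtain ⟨α, hup, hdown⟩ := exists_prop_of_or (h.one_sided_right hc hq hx₂)
  obtain ⟨β, hup', hdown'⟩ := exists_prop_of_or (h.one_sided_left hc hp hx₁)
  have hloc : ∀ u ∈ U, ∀ᶠ v in 𝓝[U] u,
      ((y₀ < u.2 ∨ u.2 = y₀ ∧ (x₂ < u.1 ∧ α ∨ u.1 < x₁ ∧ β)) ↔
        (y₀ < v.2 ∨ v.2 = y₀ ∧ (x₂ < v.1 ∧ α ∨ v.1 < x₁ ∧ β))) := by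
    rintro ⟨a, b⟩ hu
    have hno' := hno _ hu
    have hx : x₁ < x₂ := hx₁.trans hx₂
    rcases lt_trichotomy b y₀ with hb | rfl | hb
    · filter_upwards [eventually_nhdsWithin_snd (gt_mem_nhds hb)] with v hv
      grind
    · rcases lt_or_ge a x₁ with ha | ha
      · by_cases hβ : β
        · filter_upwards [eventually_nhdsWithin_fst (gt_mem_nhds ha),
            nhdsWithin_le_nhds (hdown' hβ a ha), self_mem_nhdsWithin] with v hv hv' hvU
          have := hv' (h.subset hvU)
          grind
        · filter_upwards [eventually_nhdsWithin_fst (gt_mem_nhds ha),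
            nhdsWithin_le_nhds (hup' hβ a ha), self_mem_nhdsWithin] with v hv hv' hvU
          have := hv' (h.subset hvU)
          grind
      · have ha' : x₂ < a := lt_of_not_ge fun hle => hno' rfl ⟨ha, hle⟩
        by_cases hα : α
        · filter_upwards [eventually_nhdsWithin_fst (lt_mem_nhds ha'),
            nhdsWithin_le_nhds (hdown hα a ha'), self_mem_nhdsWithin] with v hv hv' hvU
          have := hv' (h.subset hvU)
          grind
        · filter_upwards [eventually_nhdsWithin_fst (lt_mem_nhds ha'),
            nhdsWithin_le_nhds (hup hα a ha'), self_mem_nhdsWithin] with v hv hv' hvU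
          have := hv' (h.subset hvU)
          grind
    · filter_upwards [eventually_nhdsWithin_snd (lt_mem_nhds hb)] with v hv
      exact iff_of_true (.inl hb) (.inl hv)
  obtain ⟨k, hk, hky⟩ := exists_snd_lt_of_mem_interior hc
  obtain ⟨u, hu, huk⟩ := h.bot k hk
  obtain ⟨l, hl, hly⟩ := exists_lt_snd_of_mem_interior hc
  obtain ⟨v, hv, hvl⟩ := h.top l hl
  have hiff := h.preconn_sub.induction₂ _ hloc (fun _ _ _ _ _ _ => Iff.trans)
    (fun _ _ _ _ => Iff.symm) hv hu
  have huy : u.2 < y₀ := huk.trans_lt hky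
  exact (hiff.1 (.inl (hly.trans_le hvl))).elim huy.not_gt fun he => huy.ne he.1

lemma exists_mem_horizontal (h : SpansOrthoconvex K U) {x₀ x₁ x₂ y₀ : ℝ}
    (hc : (x₀, y₀) ∈ interior K) (hp : (x₁, y₀) ∉ interior K) (hq : (x₂, y₀) ∉ interior K)
    (hx : x₀ ∈ uIcc x₁ x₂) : ∃ u ∈ U, u.2 = y₀ ∧ u.1 ∈ uIcc x₁ x₂ := by
  wlog hle : x₁ ≤ x₂ generalizing x₁ x₂
  · rw [uIcc_comm] at hx ⊢
    exact this hq hp hx (not_le.1 hle).le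
  rw [uIcc_of_le hle] at hx ⊢
  refine h.exists_mem_horizontal_of_lt hc hp hq (hx.1.lt_of_ne ?_) (hx.2.lt_of_ne ?_)
  · rintro rfl
    exact hp hc
  · rintro rfl
    exact hq hc

lemma exists_mem_vertical (h : SpansOrthoconvex K U) {x₀ y₀ y₁ y₂ : ℝ}
    (hc : (x₀, y₀) ∈ interior K) (hp : (x₀, y₁) ∉ interior K) (hq : (x₀, y₂) ∉ interior K)
    (hy : y₀ ∈ uIcc y₁ y₂) : ∃ u ∈ U, u.1 = x₀ ∧ u.2 ∈ uIcc y₁ y₂ := by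
  obtain ⟨u, hu, hu'⟩ := h.reflectDiag.exists_mem_horizontal (x₀ := y₀) (x₁ := y₁) (x₂ := y₂)
    (y₀ := x₀) (by rw [← Homeomorph.preimage_interior]; exact hc)
    (by rw [← Homeomorph.preimage_interior]; exact hp)
    (by rw [← Homeomorph.preimage_interior]; exact hq) hy
  exact ⟨_, hu, hu'⟩

/-- If both corner paths between two non-interior points meet the interior of `K`, then
`U` meets the path with corner `(p.1, q.2)`. -/
lemma lpath_inter_nonempty (h : SpansOrthoconvex K U) {p q : Pt} (hp : p ∉ interior K)
    (hq : q ∉ interior K) (h₁ : (lpath p (p.1, q.2) q ∩ interior K).Nonempty)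
    (h₂ : (lpath p (q.1, p.2) q ∩ interior K).Nonempty) :
    (lpath p (p.1, q.2) q ∩ U).Nonempty := by
  obtain ⟨a, b⟩ := p
  obtain ⟨d, e⟩ := q
  obtain ⟨⟨x, y⟩, hxy, hxyK⟩ := h₁
  obtain ⟨⟨s, t⟩, hst, hstK⟩ := h₂
  simp only [lpath, mem_union, mem_segment_vertical, mem_segment_horizontal] at hxy hst
  suffices ∃ u ∈ U, (u.1 = a ∧ u.2 ∈ uIcc b e) ∨ (u.2 = e ∧ u.1 ∈ uIcc a d) by
    obtain ⟨⟨x, y⟩, hu, hu'⟩ := this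
    refine ⟨(x, y), ?_, hu⟩
    simpa only [lpath, mem_union, mem_segment_vertical, mem_segment_horizontal] using hu'
  by_cases hc : (a, e) ∈ interior K
  · rcases hst with ⟨rfl, hs⟩ | ⟨rfl, ht⟩
    · obtain ⟨u, hu, hu'⟩ := h.exists_mem_corner hc hp hq hstK hs
      exact ⟨u, hu, by rwa [uIcc_comm t e]⟩
    · obtain ⟨u, hu, hu'⟩ := h.reflectDiag.exists_mem_corner (x₀ := e) (y₀ := a) (x₁ := b)
        (y₁ := s) (s := t) (by rw [← Homeomorph.preimage_interior]; exact hc)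
        (by rw [← Homeomorph.preimage_interior]; exact hq)
        (by rw [← Homeomorph.preimage_interior]; exact hp)
        (by rw [← Homeomorph.preimage_interior]; exact hstK) (by rwa [uIcc_comm])
      exact ⟨_, hu, by rw [uIcc_comm b e]; exact hu'.symm⟩
  · rcases hxy with ⟨rfl, hy⟩ | ⟨rfl, hx⟩
    · obtain ⟨u, hu, hu'⟩ := h.exists_mem_vertical hxyK hp hc hy
      exact ⟨u, hu, .inl hu'⟩
    · obtain ⟨u, hu, hu'⟩ := h.exists_mem_horizontal hxyK hc hq hx
      exact ⟨u, hu, .inr hu'⟩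

end SpansOrthoconvex

lemma RectObstacle.spansOrthoconvex (ω : RectObstacle) {U : Set Pt} (hsub : U ⊆ ω.carrier)
    (htouch : ω.TouchesExtremes U) (hconn : IsPreconnected U) :
    SpansOrthoconvex ω.carrier U := by
  obtain ⟨⟨l, hl, hlx⟩, ⟨r, hr, hrx⟩, ⟨b, hb, hby⟩, t, ht, hty⟩ := htouch
  have h₁ := ω.compact'.image continuous_fst
  have h₂ := ω.compact'.image continuous_snd
  exact
    { vert := fun hp hq h₁ h₂ => ω.ortho _ hp _ hq (.inl rfl)
        (mem_segment_vertical.2 ⟨rfl, Icc_subset_uIcc ⟨h₁, h₂⟩⟩)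
      horiz := fun hp hq h₁ h₂ => ω.ortho _ hp _ hq (.inr rfl)
        (mem_segment_horizontal.2 ⟨rfl, Icc_subset_uIcc ⟨h₁, h₂⟩⟩)
      preconn := ω.connected'.isPreconnected
      subset := hsub
      preconn_sub := hconn
      left := fun k hk => ⟨l, hl, hlx ▸ csInf_le h₁.bddBelow (mem_image_of_mem _ hk)⟩
      right := fun k hk => ⟨r, hr, hrx ▸ le_csSup h₁.bddAbove (mem_image_of_mem _ hk)⟩
      bot := fun k hk => ⟨b, hb, hby ▸ csInf_le h₂.bddBelow (mem_image_of_mem _ hk)⟩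
      top := fun k hk => ⟨t, ht, hty ▸ le_csSup h₂.bddAbove (mem_image_of_mem _ hk)⟩ }

lemma lpath_comm (p c q : Pt) : lpath p c q = lpath q c p := by
  rw [lpath, lpath, segment_symm ℝ p c, segment_symm ℝ c q, union_comm]

/-- a connected set of segments inside `ω` intersecting the four extreme
edges of `ω` is a skeleton for `ω`. -/
theorem connected_touching_is_skeleton (ω : RectObstacle) (S : Finset (Pt × Pt))
    (hsub : segUnion S ⊆ ω.carrier)
    (htouch : ω.TouchesExtremes (segUnion S))
    (hconn : IsConnected (segUnion S)) :
    ω.IsSkeleton S := by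
  have h := ω.spansOrthoconvex hsub htouch hconn.isPreconnected
  refine ⟨hsub, fun p q hp hq hpaths => ?_⟩
  have h₁ := hpaths (p.1, q.2) (.inl rfl)
  have h₂ := hpaths (q.1, p.2) (.inr rfl)
  rintro c (rfl | rfl)
  · exact h.lpath_inter_nonempty hp hq h₁ h₂
  · rw [lpath_comm] at h₁ h₂ ⊢
    exact h.lpath_inter_nonempty hq hp h₂ h₁
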